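/- If pc ∉ Γ(x) where ⊢{c}Γ, and ⟨c,σ⟩ →α ⟨c',σ'⟩ is a single evaluation step, then pc ∉ Γ'(x) where ⊢{c'}Γ', for all x ∈ Var. -/

import Mathlib

/-- Program variables. -/
abbrev PVar := String
/-- Channels. -/
abbrev Chan := String
/-- Program points. -/
abbrev PPoint := String
/-- Values. -/
abbrev Val := ℤ
/-- Stores map program variables to values. -/
abbrev Store := PVar → Val

/-- Expressions: integer constants or variables. -/
inductive Expr where
  | const : Val → Expr
  | var : PVar → Expr
deriving DecidableEq

def Expr.eval : Expr → Store → Val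
  | .const v, _ => v
  | .var x, σ => σ x

def Expr.fv : Expr → Set PVar
  | .const _ => ∅
  | .var x => {x}

/-- Commands of the while-language with annotated outputs. -/
inductive Cmd where
  | skip : Cmd
  | seq : Cmd → Cmd → Cmd
  | assign : PVar → Expr → Cmd
  | ite : Expr → Cmd → Cmd → Cmd
  | while : Expr → Cmd → Cmd
  | out : Expr → Chan → PPoint → Cmd
deriving DecidableEq

/-- Step labels: silent, or an output (channel, value, program point). -/
inductive Label where
  | silent : Label
  | out : Chan → Val → PPoint → Label
deriving DecidableEq

abbrev Config := Cmd × Store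

/-- Small-step semantics. -/
inductive Step : Config → Label → Config → Prop where
  | skipSeq : ∀ (c : Cmd) (σ : Store), Step (.seq .skip c, σ) .silent (c, σ)
  | seq : ∀ {c₁ : Cmd} {σ : Store} {α : Label} {c₁' : Cmd} {σ' : Store} (c₂ : Cmd),
      Step (c₁, σ) α (c₁', σ') → Step (.seq c₁ c₂, σ) α (.seq c₁' c₂, σ')
  | assign : ∀ (x : PVar) (e : Expr) (σ : Store),
      Step (.assign x e, σ) .silent (.skip, Function.update σ x (e.eval σ))
  | out : ∀ (e : Expr) (a : Chan) (p : PPoint) (σ : Store),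
      Step (.out e a p, σ) (.out a (e.eval σ) p) (.skip, σ)
  | whileStep : ∀ (e : Expr) (c : Cmd) (σ : Store),
      Step (.while e c, σ) .silent (.ite e (.seq c (.while e c)) .skip, σ)
  | iteTrue : ∀ {e : Expr} {σ : Store} (c₁ c₂ : Cmd),
      e.eval σ ≠ 0 → Step (.ite e c₁ c₂, σ) .silent (c₁, σ)
  | iteFalse : ∀ {e : Expr} {σ : Store} (c₁ c₂ : Cmd),
      e.eval σ = 0 → Step (.ite e c₁ c₂, σ) .silent (c₂, σ)

/-- Prepend a label to a list of (output) labels, dropping silent labels. -/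
def Label.consTo : Label → List Label → List Label
  | .silent, ls => ls
  | l, ls => l :: ls

/-- `Steps cfg ls n cfg'`: `n` evaluation steps from `cfg` to `cfg'`, producing
the list `ls` of output labels (silent steps contribute nothing). -/
inductive Steps : Config → List Label → ℕ → Config → Prop where
  | refl : ∀ cfg, Steps cfg [] 0 cfg
  | step : ∀ {cfg : Config} {α : Label} {cfg' : Config} {ls : List Label} {n : ℕ} {cfg'' : Config},
      Step cfg α cfg' → Steps cfg' ls n cfg'' → Steps cfg (α.consTo ls) (n+1) cfg''

/-- Projection of a label list to the values output on channel `a`. -/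
def projA (a : Chan) (ls : List Label) : List Val :=
  ls.filterMap fun l => match l with
    | .silent => none
    | .out b v _ => if b = a then some v else none

/-- `⟨c,σ⟩ ⇒t_a,n ⟨c',σ'⟩`: n steps producing trace `t` of values on channel `a`. -/
def ProjSteps (cfg : Config) (a : Chan) (t : List Val) (n : ℕ) (cfg' : Config) : Prop :=
  ∃ ls, Steps cfg ls n cfg' ∧ projA a ls = t

/-- `⟨c,σ⟩ ⇒t_a`: the run of `c` from `σ` produces trace `t` on channel `a`. -/
def Produces (c : Cmd) (σ : Store) (a : Chan) (t : List Val) : Prop :=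
  ∃ n cfg', ProjSteps (c, σ) a t n cfg'

/-- A forgetful attacker: a deterministic automaton over values. -/
structure Attacker (S : Type) where
  init : S
  step : S → Val → S

/-- The attacker's state after observing trace `t`. -/
def Attacker.run {S : Type} (A : Attacker S) (t : List Val) : S :=
  t.foldl A.step A.init

/-- The counting variant `A^ω` of an attacker. -/
def Attacker.omega {S : Type} (A : Attacker S) : Attacker (S × ℕ) where
  init := (A.init, 0)
  step := fun sn v => (A.step sn.1 v, sn.2 + 1)

/-- Attacker knowledge `k(A,c,a,t)`. -/
def know {S : Type} (A : Attacker S) (c : Cmd) (a : Chan) (t : List Val) : Set Store :=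
  { ρ | ∃ t', Produces c ρ a t' ∧ A.run t' = A.run t }

/-- Exclusion knowledge `ek(A,c,a,t)`. -/
def ek {S : Type} (A : Attacker S) (c : Cmd) (a : Chan) (t : List Val) : Set Store :=
  (know A c a t)ᶜ

/-- Full progress knowledge `k#(A,c,a,t)`. -/
def kSharp {S : Type} (A : Attacker S) (c : Cmd) (a : Chan) (t : List Val) : Set Store :=
  { ρ | ∃ t' v, Produces c ρ a (t' ++ [v]) ∧ A.omega.run t' = A.omega.run t }

/-- Exclusion version `ek#(A,c,a,t)`. -/
def ekSharp {S : Type} (A : Attacker S) (c : Cmd) (a : Chan) (t : List Val) : Set Store :=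
  (kSharp A c a t)ᶜ

/-- AC progress knowledge `k⁺(A,c,a,t)`. -/
def kPlus {S : Type} (A : Attacker S) (c : Cmd) (a : Chan) (t : List Val) : Set Store :=
  { ρ | ∃ t' v, Produces c ρ a (t' ++ [v]) ∧ A.run t' = A.run t }

/-- Exclusion version `ek⁺(A,c,a,t)`. -/
def ekPlus {S : Type} (A : Attacker S) (c : Cmd) (a : Chan) (t : List Val) : Set Store :=
  (kPlus A c a t)ᶜ

/-- A dynamic policy: an equivalence relation on stores per channel and execution point. -/
structure DynPolicy where
  rel : Chan → Cmd → Store → ℕ → Store → Store → Prop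
  isEquiv : ∀ a c σ n, Equivalence (rel a c σ n)

/-- Progress-insensitive security of `c` for policy `D` against attacker `A`
on channel `a` for initial store `σ`. -/
def PISecure {S : Type} (c : Cmd) (D : DynPolicy) (A : Attacker S) (a : Chan) (σ : Store) : Prop :=
  ∀ t n c' σ' v, ProjSteps (c, σ) a t n (c', σ') →
    (∃ cfg', ProjSteps (c', σ') a [v] 1 cfg') →
    ek A c a (t ++ [v]) \ ekSharp A c a t ⊆ { ρ | ¬ D.rel a c σ n ρ σ }

/-- AC progress-insensitive security of `c` for policy `D` against attacker `A`
on channel `a` for initial store `σ`. -/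
def ACPISecure {S : Type} (c : Cmd) (D : DynPolicy) (A : Attacker S) (a : Chan) (σ : Store) : Prop :=
  ∀ t n c' σ' v, ProjSteps (c, σ) a t n (c', σ') →
    (∃ cfg', ProjSteps (c', σ') a [v] 1 cfg') →
    ek A c a (t ++ [v]) \ ekPlus A c a t ⊆ { ρ | ¬ D.rel a c σ n ρ σ }

/-- Two-run progress-insensitive security. -/
def TwoRunPISecure (c : Cmd) (D : DynPolicy) (a : Chan) (σ : Store) : Prop :=
  ∀ t n cn σn v, ProjSteps (c, σ) a t n (cn, σn) →
    (∃ cfg', ProjSteps (cn, σn) a [v] 1 cfg') →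
    ∀ ρ t' v', D.rel a c σ n ρ σ → Produces c ρ a (t' ++ [v']) → t'.length = t.length →
      v' = v

/-- A counting attacker always remembers at least how many outputs it has seen. -/
def Attacker.Counting {S : Type} (A : Attacker S) : Prop :=
  ∀ t t' : List Val, A.run t = A.run t' → t.length = t'.length

/-- A command is quasi-constant if, per channel, all its traces are prefixes of
one fixed (possibly infinite) trace. -/
def QuasiConstant (c : Cmd) : Prop :=
  ∀ a : Chan, ∃ u : ℕ → Val, ∀ σ t, Produces c σ a t →
    ∀ i : Fin t.length, t.get i = u i.val

/-- The variables of the dependency type system. -/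
inductive TVar where
  | pvar : PVar → TVar
  | cpoint : Chan → PPoint → TVar
  | pc : TVar
  | chan : Chan → TVar
deriving DecidableEq

/-- Type environments. -/
abbrev Env := TVar → Set TVar

/-- The identity environment. -/
def idEnv : Env := fun x => {x}

/-- Sequential composition of environments: `(Γ₂;Γ₁)(x) = ⋃_{y ∈ Γ₂(x)} Γ₁(y)`. -/
def envComp (Γ₂ Γ₁ : Env) : Env := fun x => ⋃ y ∈ Γ₂ x, Γ₁ y

/-- Pointwise union of environments. -/
def envUnion (Γ₁ Γ₂ : Env) : Env := fun x => Γ₁ x ∪ Γ₂ x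

/-- Iterates of an environment. -/
def envIter (Γ : Env) : ℕ → Env
  | 0 => idEnv
  | n+1 => envComp (envIter Γ n) Γ

/-- The fixed point `Γ* = ⋃_{n≥0} Γⁿ`. -/
def envStar (Γ : Env) : Env := fun x => ⋃ n, envIter Γ n x

/-- Free variables of an expression, as type-system variables. -/
def fvT (e : Expr) : Set TVar := TVar.pvar '' e.fv

/-- The dependency type system `⊢{c}Γ`. -/
inductive Typing : Cmd → Env → Prop where
  | skip : Typing .skip idEnv
  | assign : ∀ (x : PVar) (e : Expr),
      Typing (.assign x e) (Function.update idEnv (.pvar x) (fvT e ∪ {TVar.pc}))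
  | seq : ∀ {c₁ : Cmd} {Γ₁ : Env} {c₂ : Cmd} {Γ₂ : Env},
      Typing c₁ Γ₁ → Typing c₂ Γ₂ → Typing (.seq c₁ c₂) (envComp Γ₂ Γ₁)
  | ite : ∀ {e : Expr} {c₁ : Cmd} {Γ₁ : Env} {c₂ : Cmd} {Γ₂ : Env},
      Typing c₁ Γ₁ → Typing c₂ Γ₂ →
      Typing (.ite e c₁ c₂)
        (Function.update
          (envUnion (envComp Γ₁ (Function.update idEnv .pc ({TVar.pc} ∪ fvT e)))
                    (envComp Γ₂ (Function.update idEnv .pc ({TVar.pc} ∪ fvT e))))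
          .pc {TVar.pc})
  | whileT : ∀ {e : Expr} {c : Cmd} {Γc : Env}, Typing c Γc →
      Typing (.while e c)
        (Function.update
          (envStar (envComp Γc (Function.update idEnv .pc ({TVar.pc} ∪ fvT e))))
          .pc {TVar.pc})
  | out : ∀ (e : Expr) (a : Chan) (p : PPoint),
      Typing (.out e a p)
        (Function.update
          (Function.update idEnv (.cpoint a p)
            (fvT e ∪ {TVar.pc, TVar.chan a, TVar.cpoint a p}))
          (.chan a) {TVar.pc, TVar.chan a})

/-- `σ ≡_{Γ(x)} ρ`: the stores agree on all program variables in `Γ(x)`. -/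
def eqG (Γ : Env) (x : TVar) (σ ρ : Store) : Prop :=
  ∀ y : PVar, TVar.pvar y ∈ Γ x → σ y = ρ y

/-- A dynamic policy approximation: an equivalence relation on stores per
channel–program-point pair. -/
structure PolApprox where
  rel : Chan → PPoint → Store → Store → Prop
  isEquiv : ∀ a p, Equivalence (rel a p)

/-- `c : A` is a sound approximation of dynamic policy `D`. -/
def SoundApprox (c : Cmd) (A : PolApprox) (D : DynPolicy) : Prop :=
  ∀ σ n ls c' σ' a v p cfg'',
    Steps (c, σ) ls n (c', σ') → Step (c', σ') (.out a v p) cfg'' →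
    ∀ ρ₁ ρ₂, D.rel a c σ n ρ₁ ρ₂ → A.rel a p ρ₁ ρ₂

theorem Typing.unique {c : Cmd} {Γ₁ Γ₂ : Env} (h₁ : Typing c Γ₁) (h₂ : Typing c Γ₂) :
    Γ₁ = Γ₂ := by
  induction h₁ generalizing Γ₂ with
  | skip => cases h₂; rfl
  | assign x e => cases h₂; rfl
  | out e a p => cases h₂; rfl
  | seq _ _ ih₁ ih₂ =>
    cases h₂ with
    | seq a b => rw [ih₁ a, ih₂ b]
  | ite _ _ ih₁ ih₂ =>
    cases h₂ with
    | ite a b => rw [ih₁ a, ih₂ b]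
  | whileT _ ih =>
    cases h₂ with
    | whileT a => rw [ih a]

theorem Typing.at_pc {c : Cmd} {Γ : Env} (h : Typing c Γ) : Γ .pc = {TVar.pc} := by
  induction h with
  | skip => rfl
  | assign x e => simp [idEnv]
  | out e a p => simp [idEnv]
  | seq _ _ ih₁ ih₂ => simp [envComp, ih₁, ih₂]
  | ite _ _ _ _ => simp
  | whileT _ _ => simp

theorem pc_mem_guard (e : Expr) (z : TVar) :
    TVar.pc ∈ (Function.update idEnv .pc ({TVar.pc} ∪ fvT e) : Env) z ↔ z = .pc := by
  by_cases hz : z = .pc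
  · subst hz; simp
  · simp [Function.update_of_ne hz, idEnv, hz, eq_comm]

theorem pc_mem_comp_guard (Γ : Env) (e : Expr) (x : TVar) :
    TVar.pc ∈ envComp Γ (Function.update idEnv .pc ({TVar.pc} ∪ fvT e)) x ↔
      TVar.pc ∈ Γ x := by
  simp only [envComp, Set.mem_iUnion, pc_mem_guard]
  simp

theorem step_pc_mem {cfg cfg' : Config} {α : Label} (hstep : Step cfg α cfg') :
    ∀ {Γ Γ' : Env}, Typing cfg.1 Γ → Typing cfg'.1 Γ' →
      ∀ x : TVar, TVar.pc ∈ Γ' x → TVar.pc ∈ Γ x := by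
  induction hstep with
  | skipSeq c σ =>
    intro Γ Γ' h h' x hx
    cases h with
    | seq a b =>
      cases a
      rw [b.unique h']
      simpa [envComp, idEnv] using hx
  | seq c₂ _ ih =>
    intro Γ Γ' h h' x hx
    cases h with
    | seq a b =>
      cases h' with
      | seq a' b' =>
        rw [b.unique b']
        simp only [envComp, Set.mem_iUnion] at hx ⊢
        obtain ⟨y, hy, hpc⟩ := hx
        exact ⟨y, hy, ih a a' y hpc⟩
  | assign y e σ =>
    intro Γ Γ' h h' x hx
    cases h'
    have hxe : TVar.pc = x := hx
    rw [← hxe, h.at_pc]; rfl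
  | out e a p σ =>
    intro Γ Γ' h h' x hx
    cases h'
    have hxe : TVar.pc = x := hx
    rw [← hxe, h.at_pc]; rfl
  | whileStep e c σ =>
    intro Γ Γ' h h' x hx
    by_cases hxp : x = .pc
    · subst hxp; rw [h.at_pc]; rfl
    cases h' with
    | ite hs hk =>
      cases hk
      cases hs with
      | seq a w =>
        rw [← w.unique h]
        rw [Function.update_of_ne hxp] at hx
        rcases hx with hx | hx
        · rw [pc_mem_comp_guard] at hx
          cases w with
          | whileT b =>
            have hab := a.unique b
            subst hab
            simp only [envComp, Set.mem_iUnion] at hx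
            obtain ⟨y, hy, hpc⟩ := hx
            rw [Function.update_of_ne hxp] at hy ⊢
            obtain ⟨n, hn⟩ := Set.mem_iUnion.1 hy
            refine Set.mem_iUnion.2 ⟨n + 1, ?_⟩
            exact Set.mem_iUnion₂.2 ⟨y, hn, (pc_mem_comp_guard _ e y).2 hpc⟩
        · rw [pc_mem_comp_guard] at hx
          exact absurd (Eq.symm hx) hxp
  | iteTrue c₁ c₂ _ =>
    intro Γ Γ' h h' x hx
    by_cases hxp : x = .pc
    · subst hxp; rw [h.at_pc]; rfl
    cases h with
    | ite a b =>
      rw [Function.update_of_ne hxp]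
      have hab := a.unique h'
      subst hab
      exact Or.inl ((pc_mem_comp_guard _ _ x).2 hx)
  | iteFalse c₁ c₂ _ =>
    intro Γ Γ' h h' x hx
    by_cases hxp : x = .pc
    · subst hxp; rw [h.at_pc]; rfl
    cases h with
    | ite a b =>
      rw [Function.update_of_ne hxp]
      have hab := b.unique h'
      subst hab
      exact Or.inr ((pc_mem_comp_guard _ _ x).2 hx)

/-- a single evaluation step does not add a `pc` dependency. -/
theorem step_preserves_no_pc {c c' : Cmd} {σ σ' : Store} {α : Label} {Γ Γ' : Env}
    (hty : Typing c Γ) (hstep : Step (c, σ) α (c', σ')) (hty' : Typing c' Γ') :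
    ∀ x : TVar, TVar.pc ∉ Γ x → TVar.pc ∉ Γ' x := by
  exact fun x hx hx' => hx (step_pc_mem hstep hty hty' x hx')
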